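/- Let D ∈ H⁴ with fundamental invariants J₂, …, J₁₀. There exist g ∈ SO(3) and δ, σ ∈ ℝ with g·D = NF_trig(δ, σ) (i.e., D lies in the closed trigonal stratum) if and only if the following eight relations and one inequality hold: 192J₆ = −51J₂³ + 216J₂J₄ + 10J₃²; 36J₇ = −2J₂²J₃ + 6J₃J₄ + 27J₂J₅; 768J₄² = −99J₂⁴ + 552J₂²J₄ + 10J₂J₃² + 240J₃J₅; 240J₈ = −33J₂⁴ + 96J₂²J₄ + 30J₂J₃² + 40J₃J₅; 576J₄J₅ = −41J₂³J₃ + 120J₂J₃J₄ + 216J₂²J₅ + 30J₃³; 1152J₉ = −99J₂³J₃ + 296J₂J₃J₄ + 648J₂²J₅ + 10J₃³; 1440J₅² = −11J₂⁵ + 32J₂³J₄ − 70J₂²J₃² + 240J₂J₃J₅ + 240J₃²J₄; 8640J₁₀ = −891J₂⁵ + 2592J₂³J₄ + 730J₂²J₃² + 2160J₂J₃J₅ + 240J₃²J₄; and 2J₂(J₂² − 3J₄)² − 35J₅² ≥ 0. Moreover, if in addition 3J₄ − J₂² ≠ 0 and 98J₄ − 41J₂² ≠ 0, then g, δ, σ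 can be chosen with δ = −J₅ / (4(J₂² − 3J₄)), σ ≥ 0 and J₂ = 280δ² + 16σ². -/

import Mathlib

open Matrix BigOperators

abbrev Mat3 := Matrix (Fin 3) (Fin 3) ℝ
abbrev T4 := Fin 3 → Fin 3 → Fin 3 → Fin 3 → ℝ

/-- `g ∈ SO(3)`: real orthogonal 3×3 matrix of determinant 1. -/
def IsSO3 (g : Mat3) : Prop := g * gᵀ = 1 ∧ g.det = 1

/-- A harmonic fourth-order tensor: totally symmetric and traceless. -/
def IsHarm (D : T4) : Prop :=
  (∀ i j k l, D i j k l = D j i k l) ∧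
  (∀ i j k l, D i j k l = D i k j l) ∧
  (∀ i j k l, D i j k l = D i j l k) ∧
  (∀ i j, ∑ k, D k k i j = 0)

/-- The action of a rotation `g` on a fourth-order tensor. -/
noncomputable def act (g : Mat3) (D : T4) : T4 := fun i j k l =>
  ∑ p, ∑ q, ∑ r, ∑ s, g i p * g j q * g k r * g l s * D p q r s

/-- `D²`, the square of a fourth-order tensor. -/
noncomputable def sqT (D : T4) : T4 := fun i j k l => ∑ p, ∑ q, D i j p q * D p q k l

/-- `D³`, the cube of a fourth-order tensor. -/
noncomputable def cbT (D : T4) : T4 := fun i j k l => ∑ p, ∑ q, sqT D i j p q * D p q k l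

/-- The second-order Boehler covariant `d₂(D) j l = ∑ᵢ (D²) i j i l`. -/
noncomputable def d2 (D : T4) : Mat3 := Matrix.of fun j l => ∑ i, sqT D i j i l

/-- The second-order covariant `d₃(D) j l = ∑ᵢ (D³) i j i l`. -/
noncomputable def d3 (D : T4) : Mat3 := Matrix.of fun j l => ∑ i, cbT D i j i l

/-- Fundamental invariant `J₂ = tr d₂`. -/
noncomputable def J2 (D : T4) : ℝ := (d2 D).trace
/-- Fundamental invariant `J₃ = tr d₃`. -/
noncomputable def J3 (D : T4) : ℝ := (d3 D).trace
/-- Fundamental invariant `J₄ = tr(d₂²)`. -/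
noncomputable def J4 (D : T4) : ℝ := (d2 D * d2 D).trace
/-- Fundamental invariant `J₅ = ∑ (d₂)ᵢⱼ D i j k l (d₂)ₖₗ`. -/
noncomputable def J5 (D : T4) : ℝ :=
  ∑ i, ∑ j, ∑ k, ∑ l, d2 D i j * D i j k l * d2 D k l
/-- Fundamental invariant `J₆ = tr(d₂³)`. -/
noncomputable def J6 (D : T4) : ℝ := (d2 D * d2 D * d2 D).trace
/-- Fundamental invariant `J₇ = ∑ (d₂²)ᵢⱼ D i j k l (d₂)ₖₗ`. -/
noncomputable def J7 (D : T4) : ℝ :=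
  ∑ i, ∑ j, ∑ k, ∑ l, (d2 D * d2 D) i j * D i j k l * d2 D k l
/-- Fundamental invariant `J₈ = ∑ (d₂²)ᵢⱼ (D²) i j k l (d₂)ₖₗ`. -/
noncomputable def J8 (D : T4) : ℝ :=
  ∑ i, ∑ j, ∑ k, ∑ l, (d2 D * d2 D) i j * sqT D i j k l * d2 D k l
/-- Fundamental invariant `J₉ = ∑ (d₂²)ᵢⱼ D i j k l (d₂²)ₖₗ`. -/
noncomputable def J9 (D : T4) : ℝ :=
  ∑ i, ∑ j, ∑ k, ∑ l, (d2 D * d2 D) i j * D i j k l * (d2 D * d2 D) k l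
/-- Fundamental invariant `J₁₀ = ∑ (d₂²)ᵢⱼ (D²) i j k l (d₂²)ₖₗ`. -/
noncomputable def J10 (D : T4) : ℝ :=
  ∑ i, ∑ j, ∑ k, ∑ l, (d2 D * d2 D) i j * sqT D i j k l * (d2 D * d2 D) k l

/-- The totally symmetric tensor whose value at `(i,j,k,l)` depends only on the
multiset of indices `{i,j,k,l}`. -/
noncomputable def symT (f : Multiset (Fin 3) → ℝ) : T4 := fun i j k l => f {i, j, k, l}

/-- Normal form of a cubic (`[𝕆]`) tensor in `H⁴` with parameter `δ`
(indices `0,1,2` correspond to `1,2,3`). -/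
noncomputable def NFcubic (δ : ℝ) : T4 := symT fun m =>
  if m = {0, 0, 0, 0} ∨ m = {1, 1, 1, 1} ∨ m = {2, 2, 2, 2} then 8 * δ
  else if m = {0, 0, 1, 1} ∨ m = {0, 0, 2, 2} ∨ m = {1, 1, 2, 2} then -(4 * δ)
  else 0

/-- Normal form of a transversely isotropic (`[O(2)]`) tensor in `H⁴` with parameter `δ`. -/
noncomputable def NFti (δ : ℝ) : T4 := symT fun m =>
  if m = {0, 0, 0, 0} ∨ m = {1, 1, 1, 1} then 3 * δ
  else if m = {2, 2, 2, 2} then 8 * δ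
  else if m = {0, 0, 1, 1} then δ
  else if m = {0, 0, 2, 2} ∨ m = {1, 1, 2, 2} then -(4 * δ)
  else 0

/-- Normal form of a trigonal (`[𝔻₃]`) tensor in `H⁴` with parameters `δ, σ`. -/
noncomputable def NFtrig (δ σ : ℝ) : T4 := symT fun m =>
  if m = {0, 0, 0, 0} ∨ m = {1, 1, 1, 1} then 3 * δ
  else if m = {2, 2, 2, 2} then 8 * δ
  else if m = {0, 0, 1, 1} then δ
  else if m = {0, 0, 2, 2} ∨ m = {1, 1, 2, 2} then -(4 * δ)
  else if m = {0, 0, 1, 2} then -σ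
  else if m = {1, 1, 1, 2} then σ
  else 0

/-- Normal form of a tetragonal (`[𝔻₄]`) tensor in `H⁴` with parameters `δ, σ`. -/
noncomputable def NFtetra (δ σ : ℝ) : T4 := symT fun m =>
  if m = {0, 0, 0, 0} ∨ m = {1, 1, 1, 1} then 3 * δ - σ
  else if m = {2, 2, 2, 2} then 8 * δ
  else if m = {0, 0, 1, 1} then δ + σ
  else if m = {0, 0, 2, 2} ∨ m = {1, 1, 2, 2} then -(4 * δ)
  else 0

/-- Normal form of an orthotropic (`[𝔻₂]`) tensor in `H⁴` with parameters `λ₁, λ₂, λ₃`. -/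
noncomputable def NForth (l1 l2 l3 : ℝ) : T4 := symT fun m =>
  if m = {0, 0, 0, 0} then -l2 - l3
  else if m = {1, 1, 1, 1} then -l1 - l3
  else if m = {2, 2, 2, 2} then -l1 - l2
  else if m = {0, 0, 1, 1} then l3
  else if m = {0, 0, 2, 2} then l2
  else if m = {1, 1, 2, 2} then l1
  else 0

open scoped Kronecker

/-! ### Fourth-order tensors as `9 × 9` matrices -/

/-- A fourth-order tensor, seen as the matrix of an operator on second-order tensors. -/
def T4.toMat (D : T4) : Matrix (Fin 3 × Fin 3) (Fin 3 × Fin 3) ℝ :=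
  Matrix.of fun p q => D p.1 p.2 q.1 q.2

theorem T4.toMat_injective : Function.Injective T4.toMat := by
  intro D E h
  funext i j k l
  exact congrFun (congrFun h (i, j)) (k, l)

theorem toMat_sqT (D : T4) : (sqT D).toMat = D.toMat * D.toMat := by
  ext p q
  simp [T4.toMat, sqT, Matrix.mul_apply, Fintype.sum_prod_type]

theorem toMat_cbT (D : T4) : (cbT D).toMat = (sqT D).toMat * D.toMat := by
  ext p q
  simp [T4.toMat, cbT, Matrix.mul_apply, Fintype.sum_prod_type]

theorem toMat_act (g : Mat3) (D : T4) :
    (act g D).toMat = (g ⊗ₖ g) * D.toMat * (g ⊗ₖ g)ᵀ := by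
  ext ⟨i, j⟩ ⟨k, l⟩
  simp only [T4.toMat, act, Matrix.mul_apply, Fintype.sum_prod_type, Matrix.of_apply,
    Matrix.transpose_apply, Matrix.kroneckerMap_apply, Fin.sum_univ_three]
  ring

theorem act_act (g h : Mat3) (D : T4) : act g (act h D) = act (g * h) D := by
  apply T4.toMat_injective
  simp only [toMat_act, Matrix.mul_kronecker_mul, Matrix.transpose_mul, Matrix.mul_assoc]

theorem act_one (D : T4) : act 1 D = D := by
  apply T4.toMat_injective
  simp [toMat_act]

theorem act_neg (g : Mat3) (D : T4) : act g (-D) = -act g D := by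
  funext i j k l
  simp [act]

theorem IsSO3.transpose_mul_self {g : Mat3} (hg : IsSO3 g) : gᵀ * g = 1 :=
  mul_eq_one_comm.mp hg.1

theorem IsSO3.one : IsSO3 1 := by simp [IsSO3]

theorem IsSO3.mul {g h : Mat3} (hg : IsSO3 g) (hh : IsSO3 h) : IsSO3 (g * h) := by
  refine ⟨?_, by rw [Matrix.det_mul, hg.2, hh.2, one_mul]⟩
  rw [Matrix.transpose_mul, Matrix.mul_assoc, ← Matrix.mul_assoc h, hh.1, Matrix.one_mul, hg.1]

theorem IsSO3.kronecker_transpose_mul_self {g : Mat3} (hg : IsSO3 g) :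
    (g ⊗ₖ g)ᵀ * (g ⊗ₖ g) = 1 := by
  rw [← Matrix.kroneckerMap_transpose, ← Matrix.mul_kronecker_mul, hg.transpose_mul_self,
    Matrix.one_kronecker_one]

/-! ### Equivariance of the covariants and invariance of the invariants -/

section Equivariance

variable {g : Mat3}

theorem sqT_act (hg : IsSO3 g) (D : T4) : sqT (act g D) = act g (sqT D) := by
  apply T4.toMat_injective
  have h := hg.kronecker_transpose_mul_self
  simp only [toMat_sqT, toMat_act, Matrix.mul_assoc]
  rw [← Matrix.mul_assoc (g ⊗ₖ g)ᵀ (g ⊗ₖ g), h, Matrix.one_mul]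

theorem cbT_act (hg : IsSO3 g) (D : T4) : cbT (act g D) = act g (cbT D) := by
  apply T4.toMat_injective
  have h := hg.kronecker_transpose_mul_self
  simp only [toMat_cbT, sqT_act hg, toMat_act, Matrix.mul_assoc]
  rw [← Matrix.mul_assoc (g ⊗ₖ g)ᵀ (g ⊗ₖ g), h, Matrix.one_mul]

theorem partialTrace_act (hg : IsSO3 g) (S : T4) :
    (Matrix.of fun j l => ∑ i, act g S i j i l) =
      g * (Matrix.of fun j l => ∑ i, S i j i l) * gᵀ := by
  have h : ∀ p r, ∑ i, g i p * g i r = (1 : Mat3) p r := fun p r => by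
    rw [← hg.transpose_mul_self]; simp [Matrix.mul_apply]
  ext j l
  calc ∑ i, act g S i j i l
      = ∑ p, ∑ r, (∑ i, g i p * g i r) * ∑ q, ∑ s, g j q * g l s * S p q r s := by
        simp only [act, Fin.sum_univ_three]; ring
    _ = _ := by
        simp only [h, Matrix.mul_apply, Matrix.one_apply, Fin.sum_univ_three, Matrix.of_apply,
          Matrix.transpose_apply]
        simp
        ring

theorem trace_conj (hg : IsSO3 g) (A : Mat3) : (g * A * gᵀ).trace = A.trace := by
  rw [Matrix.trace_mul_comm, ← Matrix.mul_assoc, hg.transpose_mul_self, Matrix.one_mul]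

theorem conj_mul_conj (hg : IsSO3 g) (A B : Mat3) :
    (g * A * gᵀ) * (g * B * gᵀ) = g * (A * B) * gᵀ := by
  simp only [Matrix.mul_assoc]
  rw [← Matrix.mul_assoc gᵀ g, hg.transpose_mul_self, Matrix.one_mul]

theorem d2_act (hg : IsSO3 g) (D : T4) : d2 (act g D) = g * d2 D * gᵀ := by
  rw [d2, sqT_act hg, partialTrace_act hg]; rfl

theorem d3_act (hg : IsSO3 g) (D : T4) : d3 (act g D) = g * d3 D * gᵀ := by
  rw [d3, cbT_act hg, partialTrace_act hg]; rfl

theorem bilin_act (hg : IsSO3 g) (A B : Mat3) (S : T4) :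
    ∑ i, ∑ j, ∑ k, ∑ l, (g * A * gᵀ) i j * act g S i j k l * (g * B * gᵀ) k l =
      ∑ i, ∑ j, ∑ k, ∑ l, A i j * S i j k l * B k l := by
  have key : ∀ (A B : Mat3) (S : T4), ∑ i, ∑ j, ∑ k, ∑ l, A i j * S i j k l * B k l =
      (fun p : Fin 3 × Fin 3 => A p.1 p.2) ⬝ᵥ
        (S.toMat *ᵥ fun p : Fin 3 × Fin 3 => B p.1 p.2) := fun A B S => by
    simp [dotProduct, Matrix.mulVec, T4.toMat, Fintype.sum_prod_type, Finset.mul_sum, mul_assoc]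
  have hvec : ∀ A : Mat3, (fun p : Fin 3 × Fin 3 => (g * A * gᵀ) p.1 p.2) =
      (g ⊗ₖ g) *ᵥ fun p : Fin 3 × Fin 3 => A p.1 p.2 := fun A => by
    funext ⟨i, j⟩
    simp only [Matrix.mul_apply, Matrix.mulVec, dotProduct, Fintype.sum_prod_type,
      Matrix.kroneckerMap_apply, Matrix.transpose_apply, Fin.sum_univ_three]
    ring
  have h := hg.kronecker_transpose_mul_self
  rw [key, key, hvec, hvec, toMat_act, Matrix.mulVec_mulVec, Matrix.mul_assoc, h, Matrix.mul_one,
    ← Matrix.mulVec_mulVec, ← Matrix.vecMul_transpose, ← Matrix.dotProduct_mulVec,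
    Matrix.mulVec_mulVec, h, Matrix.one_mulVec]

theorem J2_act (hg : IsSO3 g) (D : T4) : J2 (act g D) = J2 D := by rw [J2, d2_act hg, trace_conj hg, J2]
theorem J3_act (hg : IsSO3 g) (D : T4) : J3 (act g D) = J3 D := by rw [J3, d3_act hg, trace_conj hg, J3]
theorem J4_act (hg : IsSO3 g) (D : T4) : J4 (act g D) = J4 D := by
  rw [J4, d2_act hg, conj_mul_conj hg, trace_conj hg, J4]
theorem J5_act (hg : IsSO3 g) (D : T4) : J5 (act g D) = J5 D := by rw [J5, d2_act hg, bilin_act hg, J5]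
theorem J6_act (hg : IsSO3 g) (D : T4) : J6 (act g D) = J6 D := by
  rw [J6, d2_act hg, conj_mul_conj hg, conj_mul_conj hg, trace_conj hg, J6]
theorem J7_act (hg : IsSO3 g) (D : T4) : J7 (act g D) = J7 D := by
  rw [J7, d2_act hg, conj_mul_conj hg, bilin_act hg, J7]
theorem J8_act (hg : IsSO3 g) (D : T4) : J8 (act g D) = J8 D := by
  rw [J8, d2_act hg, conj_mul_conj hg, sqT_act hg, bilin_act hg, J8]
theorem J9_act (hg : IsSO3 g) (D : T4) : J9 (act g D) = J9 D := by
  rw [J9, d2_act hg, conj_mul_conj hg, bilin_act hg, J9]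
theorem J10_act (hg : IsSO3 g) (D : T4) : J10 (act g D) = J10 D := by
  rw [J10, d2_act hg, conj_mul_conj hg, sqT_act hg, bilin_act hg, J10]

theorem IsHarm.act {D : T4} (hg : IsSO3 g) (hD : IsHarm D) : IsHarm (act g D) := by
  obtain ⟨h1, h2, h3, h4⟩ := hD
  have h : ∀ p q, ∑ i, g i p * g i q = (1 : Mat3) p q := fun p q => by
    rw [← hg.transpose_mul_self]; simp [Matrix.mul_apply]
  refine ⟨fun i j k l => ?_, fun i j k l => ?_, fun i j k l => ?_, fun i j => ?_⟩
  · unfold _root_.act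
    rw [Finset.sum_comm]
    refine Finset.sum_congr rfl fun p _ => Finset.sum_congr rfl fun q _ =>
      Finset.sum_congr rfl fun r _ => Finset.sum_congr rfl fun s _ => ?_
    rw [h1]; ring
  · unfold _root_.act
    refine Finset.sum_congr rfl fun p _ => ?_
    rw [Finset.sum_comm]
    refine Finset.sum_congr rfl fun q _ =>
      Finset.sum_congr rfl fun r _ => Finset.sum_congr rfl fun s _ => ?_
    rw [h2]; ring
  · unfold _root_.act
    refine Finset.sum_congr rfl fun p _ => Finset.sum_congr rfl fun q _ => ?_
    rw [Finset.sum_comm]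
    refine Finset.sum_congr rfl fun r _ => Finset.sum_congr rfl fun s _ => ?_
    rw [h3]; ring
  · calc ∑ k, _root_.act g D k k i j
        = ∑ p, ∑ q, (∑ k, g k p * g k q) * ∑ r, ∑ s, g i r * g j s * D p q r s := by
          simp only [_root_.act, Fin.sum_univ_three]; ring
      _ = ∑ r, ∑ s, g i r * g j s * ∑ k, D k k r s := by
          simp only [h, Matrix.one_apply, Fin.sum_univ_three]
          simp
          ring
      _ = 0 := by simp only [h4]; simp

end Equivariance

/-! ### Coordinates on harmonic tensors -/

/-- The harmonic tensor with prescribed components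
`u = D₂₂₂₂`, `p = D₂₂₀₀`, `r = D₂₂₀₁`, `v = D₂₂₂₀`, `v' = D₂₂₂₁`, `s = D₂₀₀₀`, `t = D₂₀₀₁`,
`w = D₀₀₀₁` and `m = D₀₀₁₁`. -/
def harmT (u p r v v' s t w m : ℝ) : T4 := fun i j =>
  match i, j with
  | 0, 0 => !![-m - p, w, s; w, m, t; s, t, p]
  | 0, 1 | 1, 0 => !![w, m, t; m, -w - r, -s - v; t, -s - v, r]
  | 0, 2 | 2, 0 => !![s, t, p; t, -s - v, r; p, r, v]
  | 1, 1 => !![m, -w - r, -s - v; -w - r, u + p - m, -t - v'; -s - v, -t - v', -u - p]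
  | 1, 2 | 2, 1 => !![t, -s - v, r; -s - v, -t - v', -u - p; r, -u - p, v']
  | 2, 2 => !![p, r, v; r, -u - p, v'; v, v', u]

theorem IsHarm.eq_harmT {D : T4} (hD : IsHarm D) :
    D = harmT (D 2 2 2 2) (D 2 2 0 0) (D 2 2 0 1) (D 2 2 2 0) (D 2 2 2 1) (D 2 0 0 0) (D 2 0 0 1)
      (D 0 0 0 1) (D 0 0 1 1) := by
  obtain ⟨h1, h2, h3, h4⟩ := hD
  simp only [Fin.sum_univ_three] at h4
  have e00 := h4 0 0
  have e01 := h4 0 1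
  have e02 := h4 0 2
  have e11 := h4 1 1
  have e12 := h4 1 2
  have e22 := h4 2 2
  funext i j k l
  fin_cases i <;> fin_cases j <;> fin_cases k <;> fin_cases l <;>
    simp [harmT] <;> grind

theorem NFtrig_eq_harmT (δ σ : ℝ) :
    NFtrig δ σ = harmT (8 * δ) (-(4 * δ)) 0 0 0 0 (-σ) 0 δ := by
  funext i j k l
  fin_cases i <;> fin_cases j <;> fin_cases k <;> fin_cases l <;>
    simp only [NFtrig, symT, harmT] <;> simp (decide := true) <;> ring

theorem isHarm_harmT (u p r v v' s t w m : ℝ) : IsHarm (harmT u p r v v' s t w m) := by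
  refine ⟨fun i j k l => ?_, fun i j k l => ?_, fun i j k l => ?_, fun i j => ?_⟩
  · fin_cases i <;> fin_cases j <;> rfl
  · fin_cases i <;> fin_cases j <;> fin_cases k <;> fin_cases l <;> rfl
  · fin_cases i <;> fin_cases j <;> fin_cases k <;> fin_cases l <;> rfl
  · fin_cases i <;> fin_cases j <;> simp [harmT, Fin.sum_univ_three] <;> ring

theorem harmT_congr {D E : T4} (hD : IsHarm D) (hE : IsHarm E)
    (hu : D 2 2 2 2 = E 2 2 2 2) (hp : D 2 2 0 0 = E 2 2 0 0) (hr : D 2 2 0 1 = E 2 2 0 1)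
    (hv : D 2 2 2 0 = E 2 2 2 0) (hv' : D 2 2 2 1 = E 2 2 2 1) (hs : D 2 0 0 0 = E 2 0 0 0)
    (ht : D 2 0 0 1 = E 2 0 0 1) (hw : D 0 0 0 1 = E 0 0 0 1) (hm : D 0 0 1 1 = E 0 0 1 1) :
    D = E := by
  rw [hD.eq_harmT, hE.eq_harmT, hu, hp, hr, hv, hv', hs, ht, hw, hm]

/-- The rotation about the last axis. -/
def rotLast (c s : ℝ) : Mat3 := !![c, -s, 0; s, c, 0; 0, 0, 1]

theorem isSO3_rotLast {c s : ℝ} (h : c ^ 2 + s ^ 2 = 1) : IsSO3 (rotLast c s) := by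
  constructor
  · ext i j
    fin_cases i <;> fin_cases j <;> simp [rotLast, Matrix.mul_apply, Fin.sum_univ_three] <;>
      linarith
  · simp [rotLast, Matrix.det_fin_three]
    linarith

theorem act_rotLast_trig {c s : ℝ} (h : c ^ 2 + s ^ 2 = 1) (δ x y : ℝ) :
    act (rotLast c s) (harmT (8 * δ) (-(4 * δ)) 0 0 0 x y 0 δ) =
      harmT (8 * δ) (-(4 * δ)) 0 0 0 (x * (c ^ 3 - 3 * c * s ^ 2) - y * (3 * c ^ 2 * s - s ^ 3))
        (x * (3 * c ^ 2 * s - s ^ 3) + y * (c ^ 3 - 3 * c * s ^ 2)) 0 δ := by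
  apply harmT_congr ((isHarm_harmT ..).act (isSO3_rotLast h)) (isHarm_harmT ..) <;>
    simp [act, rotLast, harmT, Fin.sum_univ_three] <;> ring_nf
  · linear_combination -(4 * δ) * h
  · linear_combination δ * (c ^ 2 + s ^ 2 + 1) * h

theorem exists_rotation_phase_three (x y : ℝ) : ∃ c s : ℝ, c ^ 2 + s ^ 2 = 1 ∧
    x * (c ^ 3 - 3 * c * s ^ 2) - y * (3 * c ^ 2 * s - s ^ 3) = 0 ∧
    x * (3 * c ^ 2 * s - s ^ 3) + y * (c ^ 3 - 3 * c * s ^ 2) ≤ 0 := by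
  by_cases hz : x ^ 2 + y ^ 2 = 0
  · have hx : x = 0 := by nlinarith [sq_nonneg x, sq_nonneg y]
    have hy : y = 0 := by nlinarith [sq_nonneg x, sq_nonneg y]
    exact ⟨1, 0, by norm_num, by simp [hx, hy], by simp [hx, hy]⟩
  have hpos : 0 < x ^ 2 + y ^ 2 := lt_of_le_of_ne (by positivity) (Ne.symm hz)
  set ρ := √(x ^ 2 + y ^ 2) with hρ
  have hρ2 : ρ ^ 2 = x ^ 2 + y ^ 2 := Real.sq_sqrt hpos.le
  have hρ0 : 0 < ρ := Real.sqrt_pos.mpr hpos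
  obtain ⟨z, hzpow⟩ := IsAlgClosed.exists_pow_nat_eq (⟨-y / ρ, -x / ρ⟩ : ℂ) (n := 3) (by norm_num)
  have hre := congrArg Complex.re hzpow
  have him := congrArg Complex.im hzpow
  simp [pow_succ] at hre him
  have hn : (z.re ^ 2 + z.im ^ 2) ^ 3 = 1 := by
    have h1 : (-y / ρ) ^ 2 + (-x / ρ) ^ 2 = 1 := by
      field_simp
      linarith
    rw [← h1, ← hre, ← him]
    ring
  refine ⟨z.re, z.im, ?_, ?_, ?_⟩
  · exact (pow_eq_one_iff_of_nonneg (by positivity) (by norm_num)).mp hn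
  · have : x * (-y / ρ) - y * (-x / ρ) = 0 := by ring
    rw [← hre, ← him] at this
    linarith
  · have : x * (-x / ρ) + y * (-y / ρ) = -ρ := by
      field_simp
      linarith
    rw [← hre, ← him] at this
    linarith

/-- A harmonic tensor with only weight `0` and weight `3` components about the last axis. -/
theorem exists_act_eq_NFtrig (δ x y : ℝ) :
    ∃ (g : Mat3) (σ : ℝ), IsSO3 g ∧ 0 ≤ σ ∧
      act g (harmT (8 * δ) (-(4 * δ)) 0 0 0 x y 0 δ) = NFtrig δ σ := by
  obtain ⟨c, s, h, h1, h2⟩ := exists_rotation_phase_three x y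
  refine ⟨rotLast c s, _, isSO3_rotLast h, neg_nonneg.mpr h2, ?_⟩
  rw [act_rotLast_trig h, NFtrig_eq_harmT, h1, neg_neg]

theorem sum_sq_sqT {D : T4} (hD : IsHarm D) :
    ∑ i, ∑ j, ∑ k, ∑ l, sqT D i j k l ^ 2 = 8 / 5 * J4 D - 3 / 10 * J2 D ^ 2 := by
  rw [hD.eq_harmT]
  generalize D 2 2 2 2 = u, D 2 2 0 0 = p, D 2 2 0 1 = r, D 2 2 2 0 = v, D 2 2 2 1 = v',
    D 2 0 0 0 = s, D 2 0 0 1 = t, D 0 0 0 1 = w, D 0 0 1 1 = m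
  simp [J2, J4, d2, Matrix.trace, sqT, Matrix.mul_apply, harmT, Fin.sum_univ_three]
  ring

theorem d2_isSymm {D : T4} (hD : IsHarm D) : (d2 D).IsSymm := by
  rw [hD.eq_harmT]
  ext i j
  fin_cases i <;> fin_cases j <;> simp [d2, sqT, harmT, Fin.sum_univ_three] <;> ring

section DiagonalCovariant

variable {D : T4} {x y z : ℝ}

theorem J2_of_diagonal (h : d2 D = Matrix.diagonal ![x, y, z]) : J2 D = x + y + z := by
  simp [J2, h, Matrix.trace, Fin.sum_univ_three]

theorem J4_of_diagonal (h : d2 D = Matrix.diagonal ![x, y, z]) :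
    J4 D = x ^ 2 + y ^ 2 + z ^ 2 := by
  simp [J4, h, Matrix.trace, Fin.sum_univ_three]
  ring

theorem J6_of_diagonal (h : d2 D = Matrix.diagonal ![x, y, z]) :
    J6 D = x ^ 3 + y ^ 3 + z ^ 3 := by
  simp [J6, h, Matrix.trace, Fin.sum_univ_three]
  ring

variable {a b : ℝ}

theorem J5_of_diagonal (hD : IsHarm D) (h : d2 D = Matrix.diagonal ![a, a, b]) :
    J5 D = (b - a) ^ 2 * D 2 2 2 2 := by
  rw [hD.eq_harmT] at h ⊢
  simp [J5, h, Matrix.diagonal_apply, Fin.sum_univ_three, harmT]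
  ring

theorem J7_of_diagonal (hD : IsHarm D) (h : d2 D = Matrix.diagonal ![a, a, b]) :
    J7 D = (a + b) * ((b - a) ^ 2 * D 2 2 2 2) := by
  rw [hD.eq_harmT] at h ⊢
  simp [J7, h, Matrix.diagonal_apply, Fin.sum_univ_three, harmT]
  ring

theorem J8_of_diagonal (hD : IsHarm D) (h : d2 D = Matrix.diagonal ![a, a, b]) :
    J8 D = (a + b) * ((b - a) ^ 2 * sqT D 2 2 2 2) := by
  rw [hD.eq_harmT] at h ⊢
  simp [J8, h, Matrix.diagonal_apply, Fin.sum_univ_three, sqT, harmT]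
  ring

theorem J9_of_diagonal (hD : IsHarm D) (h : d2 D = Matrix.diagonal ![a, a, b]) :
    J9 D = (a + b) ^ 2 * ((b - a) ^ 2 * D 2 2 2 2) := by
  rw [hD.eq_harmT] at h ⊢
  simp [J9, h, Matrix.diagonal_apply, Fin.sum_univ_three, harmT]
  ring

theorem J10_of_diagonal (hD : IsHarm D) (h : d2 D = Matrix.diagonal ![a, a, b]) :
    J10 D = (a + b) ^ 2 * ((b - a) ^ 2 * sqT D 2 2 2 2) := by
  rw [hD.eq_harmT] at h ⊢
  simp [J10, h, Matrix.diagonal_apply, Fin.sum_univ_three, sqT, harmT]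
  ring

end DiagonalCovariant

theorem d2_NFtrig (δ σ : ℝ) : d2 (NFtrig δ σ) = Matrix.diagonal
    ![60 * δ ^ 2 + 6 * σ ^ 2, 60 * δ ^ 2 + 6 * σ ^ 2, 160 * δ ^ 2 + 4 * σ ^ 2] := by
  rw [NFtrig_eq_harmT]
  ext i j
  fin_cases i <;> fin_cases j <;> simp [d2, sqT, harmT, Fin.sum_univ_three] <;> ring

theorem J3_NFtrig (δ σ : ℝ) : J3 (NFtrig δ σ) = 720 * δ ^ 3 - 144 * δ * σ ^ 2 := by
  rw [NFtrig_eq_harmT]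
  simp [J3, d3, cbT, sqT, harmT, Matrix.trace, Fin.sum_univ_three]
  ring

theorem sqT_NFtrig (δ σ : ℝ) : sqT (NFtrig δ σ) 2 2 2 2 = 96 * δ ^ 2 := by
  rw [NFtrig_eq_harmT]
  simp [sqT, harmT, Fin.sum_univ_three]
  ring

/-- The relations between the fundamental invariants which cut out the closed trigonal stratum. -/
theorem trigonal_relations_NFtrig {D : T4} {δ σ : ℝ} (hD : D = NFtrig δ σ) :
    192 * J6 D = -51 * (J2 D) ^ 3 + 216 * J2 D * J4 D + 10 * (J3 D) ^ 2 ∧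
       36 * J7 D = -2 * (J2 D) ^ 2 * J3 D + 6 * J3 D * J4 D + 27 * J2 D * J5 D ∧
       768 * (J4 D) ^ 2 = -99 * (J2 D) ^ 4 + 552 * (J2 D) ^ 2 * J4 D +
         10 * J2 D * (J3 D) ^ 2 + 240 * J3 D * J5 D ∧
       240 * J8 D = -33 * (J2 D) ^ 4 + 96 * (J2 D) ^ 2 * J4 D +
         30 * J2 D * (J3 D) ^ 2 + 40 * J3 D * J5 D ∧
       576 * J4 D * J5 D = -41 * (J2 D) ^ 3 * J3 D + 120 * J2 D * J3 D * J4 D +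
         216 * (J2 D) ^ 2 * J5 D + 30 * (J3 D) ^ 3 ∧
       1152 * J9 D = -99 * (J2 D) ^ 3 * J3 D + 296 * J2 D * J3 D * J4 D +
         648 * (J2 D) ^ 2 * J5 D + 10 * (J3 D) ^ 3 ∧
       1440 * (J5 D) ^ 2 = -11 * (J2 D) ^ 5 + 32 * (J2 D) ^ 3 * J4 D -
         70 * (J2 D) ^ 2 * (J3 D) ^ 2 + 240 * J2 D * J3 D * J5 D +
         240 * (J3 D) ^ 2 * J4 D ∧
       8640 * J10 D = -891 * (J2 D) ^ 5 + 2592 * (J2 D) ^ 3 * J4 D +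
         730 * (J2 D) ^ 2 * (J3 D) ^ 2 + 2160 * J2 D * J3 D * J5 D +
         240 * (J3 D) ^ 2 * J4 D ∧
       2 * J2 D * ((J2 D) ^ 2 - 3 * J4 D) ^ 2 - 35 * (J5 D) ^ 2 ≥ 0 := by
  have hH : IsHarm D := by rw [hD, NFtrig_eq_harmT]; exact isHarm_harmT ..
  have hd := d2_NFtrig δ σ
  have hu : D 2 2 2 2 = 8 * δ := by rw [hD, NFtrig_eq_harmT]; simp [harmT]
  have h2 := sqT_NFtrig δ σ
  have h3 := J3_NFtrig δ σ
  rw [← hD] at hd h2 h3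
  rw [J2_of_diagonal hd, J4_of_diagonal hd, J6_of_diagonal hd, J5_of_diagonal hH hd,
    J7_of_diagonal hH hd, J8_of_diagonal hH hd, J9_of_diagonal hH hd, J10_of_diagonal hH hd,
    h2, h3, hu]
  refine ⟨by ring, by ring, by ring, by ring, by ring, by ring, by ring, by ring, ?_⟩
  have : 0 ≤ 2048 * σ ^ 2 * (50 * δ ^ 2 - σ ^ 2) ^ 4 := by positivity
  linarith

theorem exists_isSO3_diagonalize {A : Mat3} (hA : A.IsSymm) :
    ∃ (g : Mat3) (x y z : ℝ), IsSO3 g ∧ g * A * gᵀ = Matrix.diagonal ![x, y, z] := by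
  have hH : A.IsHermitian := by rwa [Matrix.IsHermitian, Matrix.conjTranspose_eq_transpose_of_trivial]
  have key := hH.conjStarAlgAut_star_eigenvectorUnitary
  rw [Unitary.conjStarAlgAut_star_apply] at key
  set U : Mat3 := hH.eigenvectorUnitary.val
  have hU : star U * U = 1 := Unitary.coe_star_mul_self hH.eigenvectorUnitary
  have hs : star U = Uᵀ := by
    rw [Matrix.star_eq_conjTranspose, Matrix.conjTranspose_eq_transpose_of_trivial]
  have hdiag : Matrix.diagonal (RCLike.ofReal ∘ hH.eigenvalues) =
      Matrix.diagonal ![hH.eigenvalues 0, hH.eigenvalues 1, hH.eigenvalues 2] := by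
    congr 1
    funext i
    fin_cases i <;> rfl
  rw [hs, hdiag] at key
  rw [hs] at hU
  have hdet : U.det = 1 ∨ U.det = -1 := by
    have := congrArg Matrix.det hU
    rw [Matrix.det_mul, Matrix.det_transpose, Matrix.det_one] at this
    exact mul_self_eq_one_iff.mp this
  rcases hdet with h | h
  · exact ⟨Uᵀ, _, _, _, ⟨by simpa using hU, by simpa using h⟩, by simpa using key⟩
  · exact ⟨-Uᵀ, _, _, _, ⟨by simpa using hU, by simp [Matrix.det_neg, h]; norm_num⟩,
      by simpa using key⟩

/-- The rotation permuting the coordinate axes cyclically. -/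
def rotCyclic : Mat3 := !![0, 1, 0; 0, 0, 1; 1, 0, 0]

theorem isSO3_rotCyclic : IsSO3 rotCyclic := by
  constructor
  · ext i j
    fin_cases i <;> fin_cases j <;> simp [rotCyclic, Matrix.mul_apply, Fin.sum_univ_three]
  · simp [rotCyclic, Matrix.det_fin_three]

theorem rotCyclic_conj_diagonal (x y z : ℝ) :
    rotCyclic * Matrix.diagonal ![x, y, z] * rotCyclicᵀ = Matrix.diagonal ![y, z, x] := by
  ext i j
  fin_cases i <;> fin_cases j <;>
    simp [rotCyclic, Matrix.mul_apply, Matrix.diagonal_apply, Fin.sum_univ_three, Matrix.vecMul,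
      dotProduct]

theorem exists_isSO3_d2_diagonal {D : T4} (hD : IsHarm D) :
    ∃ (g : Mat3) (x y z : ℝ), IsSO3 g ∧ d2 (act g D) = Matrix.diagonal ![x, y, z] := by
  obtain ⟨g, x, y, z, hg, h⟩ := exists_isSO3_diagonalize (d2_isSymm hD)
  exact ⟨g, x, y, z, hg, by rw [d2_act hg, h]⟩

theorem discr_eq_zero_of_relations {x y z p₂ p₄ p₆ j₃ j₅ : ℝ} (e₂ : p₂ = x + y + z)
    (e₄ : p₄ = x ^ 2 + y ^ 2 + z ^ 2) (e₆ : p₆ = x ^ 3 + y ^ 3 + z ^ 3)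
    (h₁ : 192 * p₆ = -51 * p₂ ^ 3 + 216 * p₂ * p₄ + 10 * j₃ ^ 2)
    (h₃ : 768 * p₄ ^ 2 = -99 * p₂ ^ 4 + 552 * p₂ ^ 2 * p₄ + 10 * p₂ * j₃ ^ 2 + 240 * j₃ * j₅)
    (h₅ : 576 * p₄ * j₅ = -41 * p₂ ^ 3 * j₃ + 120 * p₂ * j₃ * p₄ + 216 * p₂ ^ 2 * j₅ +
      30 * j₃ ^ 3) :
    ((x - y) * (y - z) * (z - x)) ^ 2 = 0 := by
  have newton : ((x - y) * (y - z) * (z - x)) ^ 2 =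
      p₂ ^ 2 * ((p₂ ^ 2 - p₄) / 2) ^ 2 - 4 * ((p₂ ^ 2 - p₄) / 2) ^ 3 -
        4 * p₂ ^ 3 * ((p₂ ^ 3 - 3 * p₂ * p₄ + 2 * p₆) / 6) +
        18 * p₂ * ((p₂ ^ 2 - p₄) / 2) * ((p₂ ^ 3 - 3 * p₂ * p₄ + 2 * p₆) / 6) -
        27 * ((p₂ ^ 3 - 3 * p₂ * p₄ + 2 * p₆) / 6) ^ 2 := by
    rw [e₂, e₄, e₆]
    ring
  obtain rfl : p₆ = (-51 * p₂ ^ 3 + 216 * p₂ * p₄ + 10 * j₃ ^ 2) / 192 := by linarith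
  rw [newton]
  linear_combination -(p₂ ^ 2 / 4096 - p₄ / 1536) * h₃ + 5 / 18432 * j₃ * h₅

/-- Under the trigonal relations, the covariant `d₂` has a double eigenvalue. -/
theorem exists_isSO3_d2_double_eigenvalue {D : T4} (hD : IsHarm D)
    (h1 : 192 * J6 D = -51 * (J2 D) ^ 3 + 216 * J2 D * J4 D + 10 * (J3 D) ^ 2)
    (h3 : 768 * (J4 D) ^ 2 = -99 * (J2 D) ^ 4 + 552 * (J2 D) ^ 2 * J4 D +
      10 * J2 D * (J3 D) ^ 2 + 240 * J3 D * J5 D)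
    (h5 : 576 * J4 D * J5 D = -41 * (J2 D) ^ 3 * J3 D + 120 * J2 D * J3 D * J4 D +
      216 * (J2 D) ^ 2 * J5 D + 30 * (J3 D) ^ 3) :
    ∃ (g : Mat3) (a b : ℝ), IsSO3 g ∧ d2 (act g D) = Matrix.diagonal ![a, a, b] := by
  obtain ⟨g, x, y, z, hg, h⟩ := exists_isSO3_d2_diagonal hD
  have hdisc : ((x - y) * (y - z) * (z - x)) ^ 2 = 0 := by
    rw [← J2_act hg, ← J3_act hg, ← J4_act hg, ← J6_act hg] at h1
    rw [← J2_act hg, ← J3_act hg, ← J4_act hg, ← J5_act hg] at h3 h5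
    exact discr_eq_zero_of_relations (J2_of_diagonal h) (J4_of_diagonal h) (J6_of_diagonal h)
      h1 h3 h5
  rcases mul_eq_zero.mp (pow_eq_zero_iff two_ne_zero |>.mp hdisc) with h' | h'
  · rcases mul_eq_zero.mp h' with h' | h'
    · obtain rfl : x = y := by linarith
      exact ⟨g, x, z, hg, h⟩
    · obtain rfl : y = z := by linarith
      refine ⟨rotCyclic * g, y, x, isSO3_rotCyclic.mul hg, ?_⟩
      rw [← act_act, d2_act isSO3_rotCyclic, h, rotCyclic_conj_diagonal]
  · obtain rfl : z = x := by linarith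
    refine ⟨rotCyclic * (rotCyclic * g), z, y, isSO3_rotCyclic.mul (isSO3_rotCyclic.mul hg), ?_⟩
    rw [← act_act, ← act_act, d2_act isSO3_rotCyclic, d2_act isSO3_rotCyclic, h,
      rotCyclic_conj_diagonal, rotCyclic_conj_diagonal]

theorem trigonal_parameters_of_relations {a b u j X : ℝ} (hab : a ≠ b) (ha : 0 ≤ a) (hb : 0 ≤ b)
    (h1 : 192 * (a ^ 3 + a ^ 3 + b ^ 3) = -51 * (a + a + b) ^ 3 +
      216 * (a + a + b) * (a ^ 2 + a ^ 2 + b ^ 2) + 10 * j ^ 2)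
    (h2 : 36 * ((a + b) * ((b - a) ^ 2 * u)) = -2 * (a + a + b) ^ 2 * j +
      6 * j * (a ^ 2 + a ^ 2 + b ^ 2) + 27 * (a + a + b) * ((b - a) ^ 2 * u))
    (h4 : 240 * ((a + b) * ((b - a) ^ 2 * X)) = -33 * (a + a + b) ^ 4 +
      96 * (a + a + b) ^ 2 * (a ^ 2 + a ^ 2 + b ^ 2) + 30 * (a + a + b) * j ^ 2 +
      40 * j * ((b - a) ^ 2 * u))
    (h7 : 1440 * ((b - a) ^ 2 * u) ^ 2 = -11 * (a + a + b) ^ 5 +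
      32 * (a + a + b) ^ 3 * (a ^ 2 + a ^ 2 + b ^ 2) - 70 * (a + a + b) ^ 2 * j ^ 2 +
      240 * (a + a + b) * j * ((b - a) ^ 2 * u) + 240 * j ^ 2 * (a ^ 2 + a ^ 2 + b ^ 2)) :
    8 * (3 * b - 2 * a) = 45 * u ^ 2 ∧ 2 * X = 3 * u ^ 2 := by
  have hba : b - a ≠ 0 := sub_ne_zero.mpr hab.symm
  have hj : 4 * j = 9 * (b - 2 * a) * u := by
    apply mul_left_cancel₀ (pow_ne_zero 2 hba)
    linear_combination -h2
  have hj' : j = 9 / 4 * (b - 2 * a) * u := by linarith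
  subst hj'
  have hu : 8 * (3 * b - 2 * a) = 45 * u ^ 2 := by
    by_cases hb2 : b - 2 * a = 0
    · obtain rfl : b = 2 * a := by linarith
      have ha0 : a ≠ 0 := by rintro rfl; simp at hab
      apply mul_left_cancel₀ (pow_ne_zero 4 ha0)
      linear_combination -h7 / 32
    · apply mul_left_cancel₀ (pow_ne_zero 2 hb2)
      linear_combination 8 / 9 * h1
  refine ⟨hu, ?_⟩
  have hsum : a + b ≠ 0 := fun h => hab (by linarith)
  apply mul_left_cancel₀ (mul_ne_zero hsum (pow_ne_zero 2 hba))
  obtain rfl : a = (3 * b - 45 / 8 * u ^ 2) / 2 := by linarith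
  linear_combination h4 / 120

/-- A harmonic tensor whose `d₂` is transversely isotropic about the last axis, with the
eigenvalues of a trigonal tensor, and which has no weight `1` or `2` components, is trigonal. -/
theorem eq_harmT_of_d2_diagonal {D : T4} {a b : ℝ} (hD : IsHarm D)
    (h : d2 D = Matrix.diagonal ![a, a, b]) (hp : D 2 2 0 0 = -D 2 2 2 2 / 2)
    (hr : D 2 2 0 1 = 0) (hv : D 2 2 2 0 = 0) (hv' : D 2 2 2 1 = 0)
    (hab : 8 * (3 * b - 2 * a) = 45 * D 2 2 2 2 ^ 2) :
    ∃ δ x y, D = harmT (8 * δ) (-(4 * δ)) 0 0 0 x y 0 δ := by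
  have e := hD.eq_harmT
  rw [hp, hr, hv, hv'] at e
  generalize D 2 2 2 2 = u, D 2 0 0 0 = s, D 2 0 0 1 = t, D 0 0 0 1 = w, D 0 0 1 1 = m at *
  subst e
  have hb : d2 (harmT u (-u / 2) 0 0 0 s t w m) 2 2 = b := by rw [h]; simp
  have h2 := J2_of_diagonal h
  simp [J2, d2, sqT, harmT, Matrix.trace, Fin.sum_univ_three] at hb h2
  have hz : w ^ 2 + (m - u / 8) ^ 2 = 0 := by
    linear_combination h2 / 8 - hb / 2 - hab / 64
  have hw : w = 0 := by nlinarith [sq_nonneg w, sq_nonneg (m - u / 8)]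
  have hm : m = u / 8 := by nlinarith [sq_nonneg w, sq_nonneg (m - u / 8)]
  refine ⟨u / 8, s, t, ?_⟩
  rw [hw, hm]
  congr 1 <;> ring

theorem d2_apply_self_nonneg {D : T4} (hD : IsHarm D) (i : Fin 3) : 0 ≤ d2 D i i := by
  obtain ⟨h1, h2, h3, -⟩ := hD
  simp only [d2, sqT, Matrix.of_apply]
  refine Finset.sum_nonneg fun j _ => Finset.sum_nonneg fun p _ => Finset.sum_nonneg fun q _ => ?_
  rw [show D p q j i = D j i p q by grind]
  exact mul_self_nonneg _

theorem sqT_last {D : T4} (hD : IsHarm D) :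
    sqT D 2 2 2 2 = D 2 2 2 2 ^ 2 + D 2 2 0 0 ^ 2 + (D 2 2 2 2 + D 2 2 0 0) ^ 2 +
      2 * (D 2 2 0 1 ^ 2 + D 2 2 2 0 ^ 2 + D 2 2 2 1 ^ 2) := by
  rw [hD.eq_harmT]
  generalize D 2 2 2 2 = u, D 2 2 0 0 = p, D 2 2 0 1 = r, D 2 2 2 0 = v, D 2 2 2 1 = v',
    D 2 0 0 0 = s, D 2 0 0 1 = t, D 0 0 0 1 = w, D 0 0 1 1 = m
  simp [sqT, harmT, Fin.sum_univ_three]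
  ring

theorem eq_zero_of_weighted_sum_sq_eq_zero {a b c d : ℝ}
    (h : a ^ 2 + 4 * (b ^ 2 + c ^ 2 + d ^ 2) = 0) : a = 0 ∧ b = 0 ∧ c = 0 ∧ d = 0 := by
  refine ⟨?_, ?_, ?_, ?_⟩ <;> refine pow_eq_zero_iff two_ne_zero |>.mp ?_ <;>
    linarith [sq_nonneg a, sq_nonneg b, sq_nonneg c, sq_nonneg d]

theorem exists_act_eq_NFtrig_of_ne {D : T4} {a b : ℝ} (hD : IsHarm D)
    (h : d2 D = Matrix.diagonal ![a, a, b]) (hab : a ≠ b)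
    (h1 : 192 * J6 D = -51 * (J2 D) ^ 3 + 216 * J2 D * J4 D + 10 * (J3 D) ^ 2)
    (h2 : 36 * J7 D = -2 * (J2 D) ^ 2 * J3 D + 6 * J3 D * J4 D + 27 * J2 D * J5 D)
    (h4 : 240 * J8 D = -33 * (J2 D) ^ 4 + 96 * (J2 D) ^ 2 * J4 D +
      30 * J2 D * (J3 D) ^ 2 + 40 * J3 D * J5 D)
    (h7 : 1440 * (J5 D) ^ 2 = -11 * (J2 D) ^ 5 + 32 * (J2 D) ^ 3 * J4 D -
      70 * (J2 D) ^ 2 * (J3 D) ^ 2 + 240 * J2 D * J3 D * J5 D + 240 * (J3 D) ^ 2 * J4 D) :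
    ∃ (g : Mat3) (δ σ : ℝ), IsSO3 g ∧ act g D = NFtrig δ σ := by
  have ha : 0 ≤ a := by simpa [h] using d2_apply_self_nonneg hD 0
  have hb : 0 ≤ b := by simpa [h] using d2_apply_self_nonneg hD 2
  rw [J2_of_diagonal h, J4_of_diagonal h] at h1 h2 h4 h7
  rw [J6_of_diagonal h] at h1
  rw [J5_of_diagonal hD h] at h2 h4 h7
  rw [J7_of_diagonal hD h] at h2
  rw [J8_of_diagonal hD h] at h4
  obtain ⟨hu, hX⟩ := trigonal_parameters_of_relations hab ha hb h1 h2 h4 h7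
  have hz : (2 * D 2 2 0 0 + D 2 2 2 2) ^ 2 +
      4 * (D 2 2 0 1 ^ 2 + D 2 2 2 0 ^ 2 + D 2 2 2 1 ^ 2) = 0 := by
    rw [sqT_last hD] at hX
    linear_combination hX
  obtain ⟨hp, hr, hv, hv'⟩ := eq_zero_of_weighted_sum_sq_eq_zero hz
  obtain ⟨δ, x, y, e⟩ := eq_harmT_of_d2_diagonal hD h (by linarith) hr hv hv' hu
  obtain ⟨g, σ, hg, -, hgσ⟩ := exists_act_eq_NFtrig δ x y
  exact ⟨g, δ, σ, hg, by rw [e, hgσ]⟩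

/-! ### Tensors whose `d₂` is a multiple of the identity -/

theorem eq_zero_of_sum_sq_eq_zero {f : T4} (h : ∑ i, ∑ j, ∑ k, ∑ l, f i j k l ^ 2 = 0)
    (i j k l : Fin 3) : f i j k l = 0 := by
  rw [Finset.sum_eq_zero_iff_of_nonneg fun _ _ => by positivity] at h
  have h := h i (Finset.mem_univ i)
  rw [Finset.sum_eq_zero_iff_of_nonneg fun _ _ => by positivity] at h
  have h := h j (Finset.mem_univ j)
  rw [Finset.sum_eq_zero_iff_of_nonneg fun _ _ => by positivity] at h
  have h := h k (Finset.mem_univ k)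
  rw [Finset.sum_eq_zero_iff_of_nonneg fun _ _ => by positivity] at h
  exact pow_eq_zero_iff two_ne_zero |>.mp (h l (Finset.mem_univ l))

theorem sum_sq_sqT_add_smul {D : T4} (hD : IsHarm D) (t : ℝ) :
    ∑ i, ∑ j, ∑ k, ∑ l, (sqT D i j k l + t * D i j k l - t ^ 2 *
      (3 * ((1 : Mat3) i k * (1 : Mat3) j l + (1 : Mat3) i l * (1 : Mat3) j k) -
        2 * ((1 : Mat3) i j * (1 : Mat3) k l))) ^ 2 =
    8 / 5 * J4 D - 3 / 10 * J2 D ^ 2 + 2 * t * J3 D - 11 * t ^ 2 * J2 D + 180 * t ^ 4 := by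
  rw [← sum_sq_sqT hD, hD.eq_harmT]
  generalize D 2 2 2 2 = u, D 2 2 0 0 = p, D 2 2 0 1 = r, D 2 2 2 0 = v, D 2 2 2 1 = v',
    D 2 0 0 0 = s, D 2 0 0 1 = t, D 0 0 0 1 = w, D 0 0 1 1 = m
  simp [J2, J3, d2, d3, cbT, Matrix.trace, sqT, harmT, Fin.sum_univ_three, Matrix.one_apply]
  ring

/-- Regarded as endomorphisms of traceless symmetric matrices, such tensors `D` satisfy
`(D + 3t)(D - 2t) = 0`. -/
def IsQuadratic (t : ℝ) (D : T4) : Prop :=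
  ∀ i j k l, sqT D i j k l = t ^ 2 *
    (3 * ((1 : Mat3) i k * (1 : Mat3) j l + (1 : Mat3) i l * (1 : Mat3) j k) -
      2 * ((1 : Mat3) i j * (1 : Mat3) k l)) - t * D i j k l

theorem isQuadratic_of_invariants {D : T4} (hD : IsHarm D) {t : ℝ} (h2 : J2 D = 30 * t ^ 2)
    (h3 : J3 D = -30 * t ^ 3) (h4 : J4 D = 300 * t ^ 4) : IsQuadratic t D := by
  have key := sum_sq_sqT_add_smul hD t
  rw [h2, h3, h4, show (8 / 5 * (300 * t ^ 4) - 3 / 10 * (30 * t ^ 2) ^ 2 +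
    2 * t * (-30 * t ^ 3) - 11 * t ^ 2 * (30 * t ^ 2) + 180 * t ^ 4 : ℝ) = 0 by ring] at key
  intro i j k l
  linarith [eq_zero_of_sum_sq_eq_zero key i j k l]

/-- The rotation in the plane of the first and last axes. -/
def rotMid (c s : ℝ) : Mat3 := !![c, 0, -s; 0, 1, 0; s, 0, c]

theorem isSO3_rotMid {c s : ℝ} (h : c ^ 2 + s ^ 2 = 1) : IsSO3 (rotMid c s) := by
  constructor
  · ext i j
    fin_cases i <;> fin_cases j <;> simp [rotMid, Matrix.mul_apply, Fin.sum_univ_three] <;>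
      linarith
  · simp [rotMid, Matrix.det_fin_three]
    linarith

theorem act_rotMid_mul_rotLast (c s a b u p r v v' x y w m : ℝ) :
    act (rotMid c s * rotLast a b) (harmT u p r v v' x y w m) 2 2 2 2 =
      c ^ 4 * u + 4 * c ^ 3 * s * (a * v - b * v') +
      6 * c ^ 2 * s ^ 2 * (a ^ 2 * p - 2 * a * b * r - b ^ 2 * (u + p)) +
      4 * c * s ^ 3 * (a ^ 3 * x - 3 * a ^ 2 * b * y - 3 * a * b ^ 2 * (x + v) +
        b ^ 3 * (y + v')) +
      s ^ 4 * (-a ^ 4 * (m + p) - 4 * a ^ 3 * b * w + 6 * a ^ 2 * b ^ 2 * m +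
        4 * a * b ^ 3 * (w + r) + b ^ 4 * (u + p - m)) := by
  simp [act, rotMid, rotLast, harmT, Fin.sum_univ_three, Matrix.mul_apply]
  ring

theorem isCompact_isSO3 : IsCompact {g : Mat3 | IsSO3 g} := by
  have hK : IsCompact (Set.univ.pi fun _ : Fin 3 => Set.univ.pi fun _ : Fin 3 =>
      Set.Icc (-1 : ℝ) 1) :=
    isCompact_univ_pi fun _ => isCompact_univ_pi fun _ => isCompact_Icc
  refine IsCompact.of_isClosed_subset hK ?_ ?_
  · have h1 : IsClosed {g : Mat3 | g * gᵀ = 1} := isClosed_eq (by fun_prop) continuous_const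
    have h2 : IsClosed {g : Mat3 | g.det = 1} :=
      isClosed_eq (continuous_id.matrix_det) continuous_const
    exact h1.inter h2
  · intro g hg i _ j _
    have hU : g ∈ Matrix.unitaryGroup (Fin 3) ℝ := by
      rw [Matrix.mem_unitaryGroup_iff, Matrix.star_eq_conjTranspose,
        Matrix.conjTranspose_eq_transpose_of_trivial]
      exact hg.1
    exact abs_le.mp (entry_norm_bound_of_unitary hU i j)

theorem exists_isSO3_forall_act_le (D : T4) :
    ∃ g, IsSO3 g ∧ ∀ h, IsSO3 h → act h (act g D) 2 2 2 2 ≤ act g D 2 2 2 2 := by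
  have hc : ContinuousOn (fun g : Mat3 => act g D 2 2 2 2) {g | IsSO3 g} := by
    refine Continuous.continuousOn ?_
    unfold act
    refine continuous_finsetSum _ fun p _ => continuous_finsetSum _ fun q _ =>
      continuous_finsetSum _ fun r _ => continuous_finsetSum _ fun s _ => ?_
    have hij : ∀ i j, Continuous fun g : Mat3 => g i j := fun i j => continuous_apply_apply i j
    exact ((((hij 2 p).mul (hij 2 q)).mul (hij 2 r)).mul (hij 2 s)).mul continuous_const
  obtain ⟨g, hg, hmax⟩ := isCompact_isSO3.exists_isMaxOn ⟨1, IsSO3.one⟩ hc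
  refine ⟨g, hg, fun h hh => ?_⟩
  rw [act_act]
  exact hmax (hh.mul hg)

theorem eq_zero_of_forall_quartic_le {A B C E F : ℝ}
    (h : ∀ c s : ℝ, c ^ 2 + s ^ 2 = 1 →
      A * c ^ 4 + B * c ^ 3 * s + C * c ^ 2 * s ^ 2 + E * c * s ^ 3 + F * s ^ 4 ≤ A) : B = 0 := by
  let f : ℝ → ℝ := fun θ => A * Real.cos θ ^ 4 + B * Real.cos θ ^ 3 * Real.sin θ +
    C * Real.cos θ ^ 2 * Real.sin θ ^ 2 + E * Real.cos θ * Real.sin θ ^ 3 + F * Real.sin θ ^ 4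
  have hmax : IsLocalMax f 0 := Filter.Eventually.of_forall fun θ => by
    simpa [f] using h (Real.cos θ) (Real.sin θ) (Real.cos_sq_add_sin_sq θ)
  have hc := Real.hasDerivAt_cos 0
  have hs := Real.hasDerivAt_sin 0
  have hf : HasDerivAt f B 0 := by
    have := (((((hc.pow 4).const_mul A).add (((hc.pow 3).const_mul B).mul hs)).add
      (((hc.pow 2).const_mul C).mul (hs.pow 2))).add
      ((hc.const_mul E).mul (hs.pow 3))).add ((hs.pow 4).const_mul F)
    exact this.congr_deriv (by simp)
  exact hmax.hasDerivAt_eq_zero hf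

theorem exists_rotation_phase_two (x y : ℝ) : ∃ c s : ℝ, c ^ 2 + s ^ 2 = 1 ∧
    x * (c * s) + y * (c ^ 2 - s ^ 2) = 0 := by
  let f : ℝ → ℝ := fun θ => x * (Real.cos θ * Real.sin θ) + y * (Real.cos θ ^ 2 - Real.sin θ ^ 2)
  have hf : Continuous f := by fun_prop
  obtain ⟨θ, hθ⟩ : ∃ θ, f θ = 0 := by
    have h0 : f 0 = y := by simp [f]
    have h1 : f (Real.pi / 2) = -y := by simp [f]
    rcases le_total y 0 with hy | hy
    · exact mem_range_of_exists_le_of_exists_ge hf ⟨0, by linarith⟩ ⟨Real.pi / 2, by linarith⟩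
    · exact mem_range_of_exists_le_of_exists_ge hf ⟨Real.pi / 2, by linarith⟩ ⟨0, by linarith⟩
  exact ⟨_, _, Real.cos_sq_add_sin_sq θ, hθ⟩

theorem act_rotLast_harmT_weight_two (c s u p r v v' x y w m : ℝ) :
    act (rotLast c s) (harmT u p r v v' x y w m) 2 2 2 2 = u ∧
    act (rotLast c s) (harmT u p r v v' x y w m) 2 2 0 1 =
      (2 * p + u) * (c * s) + r * (c ^ 2 - s ^ 2) := by
  constructor <;> simp [act, rotLast, harmT, Fin.sum_univ_three]
  ring

/-- In a frame whose last axis maximises `n ↦ D(n,n,n,n)`, further adapted by a rotation about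
that axis, the components of weights `1` vanish and those of weight `2` are aligned. -/
theorem exists_adapted_frame {D : T4} (hD : IsHarm D) :
    ∃ (g : Mat3) (u p x y w m : ℝ), IsSO3 g ∧ act g D = harmT u p 0 0 0 x y w m ∧
      ∀ c s a b : ℝ, c ^ 2 + s ^ 2 = 1 → a ^ 2 + b ^ 2 = 1 →
        act (rotMid c s * rotLast a b) (harmT u p 0 0 0 x y w m) 2 2 2 2 ≤ u := by
  obtain ⟨g₀, hg₀, hmax⟩ := exists_isSO3_forall_act_le D
  have e₀ := (hD.act hg₀).eq_harmT
  obtain ⟨c, s, hcs, hr⟩ :=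
    exists_rotation_phase_two (2 * act g₀ D 2 2 0 0 + act g₀ D 2 2 2 2) (act g₀ D 2 2 0 1)
  have hg : IsSO3 (rotLast c s * g₀) := (isSO3_rotLast hcs).mul hg₀
  have hg1 : act (rotLast c s * g₀) D = act (rotLast c s) (act g₀ D) := (act_act ..).symm
  have hu : act (rotLast c s * g₀) D 2 2 2 2 = act g₀ D 2 2 2 2 := by
    rw [hg1, e₀, (act_rotLast_harmT_weight_two ..).1]
    rfl
  have hr' : act (rotLast c s * g₀) D 2 2 0 1 = 0 := by
    rw [hg1, e₀, (act_rotLast_harmT_weight_two ..).2, hr]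
  have hmax' : ∀ h, IsSO3 h → act h (act (rotLast c s * g₀) D) 2 2 2 2 ≤
      act (rotLast c s * g₀) D 2 2 2 2 := fun h hh => by
    rw [hu, hg1, act_act]
    exact hmax _ (hh.mul (isSO3_rotLast hcs))
  have e := (hD.act hg).eq_harmT
  generalize rotLast c s * g₀ = g at hg hr' hmax' e
  rw [hr'] at e
  generalize act g D 2 2 2 2 = u, act g D 2 2 0 0 = p, act g D 2 2 2 0 = v, act g D 2 2 2 1 = v',
    act g D 2 0 0 0 = x, act g D 2 0 0 1 = y, act g D 0 0 0 1 = w, act g D 0 0 1 1 = m at hmax' e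
  rw [e] at hmax'
  have hall : ∀ c s a b : ℝ, c ^ 2 + s ^ 2 = 1 → a ^ 2 + b ^ 2 = 1 →
      act (rotMid c s * rotLast a b) (harmT u p 0 v v' x y w m) 2 2 2 2 ≤ u := fun c s a b h h' =>
    hmax' _ ((isSO3_rotMid h).mul (isSO3_rotLast h'))
  have hv : 4 * v = 0 := by
    refine eq_zero_of_forall_quartic_le (A := u) (C := 6 * p) (E := 4 * x) (F := -(m + p))
      fun c s h => ?_
    have := hall c s 1 0 h (by norm_num)
    rw [act_rotMid_mul_rotLast] at this
    linarith
  have hv' : -4 * v' = 0 := by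
    refine eq_zero_of_forall_quartic_le (A := u) (C := -6 * (u + p)) (E := 4 * (y + v'))
      (F := u + p - m) fun c s h => ?_
    have := hall c s 0 1 h (by norm_num)
    rw [act_rotMid_mul_rotLast] at this
    linarith
  obtain rfl : v = 0 := by linarith
  obtain rfl : v' = 0 := by linarith
  exact ⟨g, u, p, x, y, w, m, hg, e, hall⟩

theorem adapted_frame_parameters {t u p x y w m : ℝ} (ht : 0 < t)
    (hT : IsQuadratic t (harmT u p 0 0 0 x y w m))
    (hmax : ∀ c s a b : ℝ, c ^ 2 + s ^ 2 = 1 → a ^ 2 + b ^ 2 = 1 →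
      act (rotMid c s * rotLast a b) (harmT u p 0 0 0 x y w m) 2 2 2 2 ≤ u) :
    p = -u / 2 ∧ 3 * u = 4 * t := by
  simp only [act_rotMid_mul_rotLast] at hmax
  have e22 := hT 2 2 2 2
  have f01 := hT 0 1 0 1
  have f02 := hT 0 2 0 2
  have f12 := hT 1 2 1 2
  have hw := hT 2 2 0 1
  have hx := hT 2 2 2 0
  have hy := hT 2 2 2 1
  simp [sqT, harmT, Fin.sum_univ_three] at e22 f01 f02 f12 hw hx hy
  have hp : p = -u / 2 := by
    by_contra hpu
    have hpq : 2 * p + u ≠ 0 := fun h => hpu (by linarith)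
    obtain rfl : w = 0 := mul_left_cancel₀ hpq (by linarith)
    obtain rfl : x = 0 := mul_left_cancel₀ hpq (by linarith)
    obtain rfl : y = 0 := mul_left_cancel₀ hpq (by linarith)
    have g01 : (2 * m + 3 * t) * (m - t) = 0 := by linear_combination f01
    have g02 : (2 * p + 3 * t) * (p - t) = 0 := by linear_combination f02
    have g12 : (2 * (-u - p) + 3 * t) * (-u - p - t) = 0 := by linear_combination f12
    have h1 := hmax (4 / 5) (3 / 5) 1 0 (by norm_num) (by norm_num)
    have h2 := hmax (4 / 5) (3 / 5) 0 1 (by norm_num) (by norm_num)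
    rcases mul_eq_zero.mp g01 with k1 | k1 <;> rcases mul_eq_zero.mp g02 with k2 | k2 <;>
      rcases mul_eq_zero.mp g12 with k3 | k3 <;> exact hpq (by linarith)
  subst hp
  refine ⟨rfl, ?_⟩
  have h1 := hmax 0 1 1 0 (by norm_num) (by norm_num)
  have h2 := hmax 0 1 (3 / 5) (4 / 5) (by norm_num) (by norm_num)
  have h3 := hmax 0 1 (3 / 5) (-4 / 5) (by norm_num) (by norm_num)
  have hu : 0 ≤ u := by linarith
  have h : (3 * u - 4 * t) * (u + 2 * t) = 0 := by linear_combination 2 * e22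
  rcases mul_eq_zero.mp h with h | h <;> linarith

theorem exists_act_eq_NFtrig_of_eq_of_pos {D : T4} {t : ℝ} (hD : IsHarm D) (ht : 0 < t)
    (h : d2 D = Matrix.diagonal ![10 * t ^ 2, 10 * t ^ 2, 10 * t ^ 2])
    (h3 : J3 D = -30 * t ^ 3) :
    ∃ (g : Mat3) (δ σ : ℝ), IsSO3 g ∧ act g D = NFtrig δ σ := by
  obtain ⟨g, u, p, x, y, w, m, hg, e, hmax⟩ := exists_adapted_frame hD
  have hdiag : Matrix.diagonal ![10 * t ^ 2, 10 * t ^ 2, 10 * t ^ 2] =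
      (10 * t ^ 2) • (1 : Mat3) := by
    ext i j
    fin_cases i <;> fin_cases j <;> simp
  have h' : d2 (act g D) = Matrix.diagonal ![10 * t ^ 2, 10 * t ^ 2, 10 * t ^ 2] := by
    rw [d2_act hg, h, hdiag, Matrix.mul_smul, Matrix.smul_mul, Matrix.mul_one, hg.1]
  have hH := hD.act hg
  have hT : IsQuadratic t (act g D) := by
    refine isQuadratic_of_invariants hH ?_ ?_ ?_
    · rw [J2_of_diagonal h']
      ring
    · rw [J3_act hg, h3]
    · rw [J4_of_diagonal h']
      ring
  rw [e] at h' hH hT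
  obtain ⟨rfl, hu⟩ := adapted_frame_parameters ht hT hmax
  obtain ⟨δ, x', y', e'⟩ := eq_harmT_of_d2_diagonal hH h' rfl rfl rfl rfl (by
    simp only [harmT]
    simp
    nlinarith)
  obtain ⟨g', σ, hg', -, hgσ⟩ := exists_act_eq_NFtrig δ x' y'
  exact ⟨g' * g, δ, σ, hg'.mul hg, by rw [← act_act, e, e', hgσ]⟩

theorem sqT_neg (D : T4) : sqT (-D) = sqT D := by
  funext i j k l
  simp [sqT]

theorem d2_neg (D : T4) : d2 (-D) = d2 D := by
  rw [d2, sqT_neg, d2]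

theorem J3_neg (D : T4) : J3 (-D) = -J3 D := by
  simp [J3, d3, cbT, sqT_neg, Matrix.trace]

theorem IsHarm.neg {D : T4} (hD : IsHarm D) : IsHarm (-D) := by
  obtain ⟨h1, h2, h3, h4⟩ := hD
  refine ⟨fun i j k l => ?_, fun i j k l => ?_, fun i j k l => ?_, fun i j => ?_⟩
  · simp [h1 i j k l]
  · simp [h2 i j k l]
  · simp [h3 i j k l]
  · simp [h4 i j]

theorem NFtrig_neg (δ σ : ℝ) : NFtrig (-δ) (-σ) = -NFtrig δ σ := by
  funext i j k l
  simp only [NFtrig, symT, Pi.neg_apply]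
  split_ifs <;> ring

theorem eq_zero_of_J2_eq_zero {D : T4} (hD : IsHarm D) (h : J2 D = 0) : D = 0 := by
  obtain ⟨h1, h2, h3, -⟩ := hD
  have e : ∑ j, ∑ i, ∑ p, ∑ q, D j i p q ^ 2 = 0 := by
    rw [← h]
    simp only [J2, d2, sqT, Matrix.trace, Matrix.diag_apply, Matrix.of_apply]
    refine Finset.sum_congr rfl fun j _ => Finset.sum_congr rfl fun i _ =>
      Finset.sum_congr rfl fun p _ => Finset.sum_congr rfl fun q _ => ?_
    rw [show D p q i j = D i j p q by grind, ← h1 i j, pow_two]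
  funext i j p q
  rw [h1]
  exact eq_zero_of_sum_sq_eq_zero e j i p q

theorem exists_act_eq_NFtrig_of_eq {D : T4} {a : ℝ} (hD : IsHarm D)
    (h : d2 D = Matrix.diagonal ![a, a, a])
    (h1 : 192 * J6 D = -51 * (J2 D) ^ 3 + 216 * J2 D * J4 D + 10 * (J3 D) ^ 2) :
    ∃ (g : Mat3) (δ σ : ℝ), IsSO3 g ∧ act g D = NFtrig δ σ := by
  rw [J2_of_diagonal h, J4_of_diagonal h, J6_of_diagonal h] at h1
  have h1 : 9 * a ^ 3 = 10 * J3 D ^ 2 := by linear_combination h1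
  obtain ⟨t, rfl, h3⟩ : ∃ t, a = 10 * t ^ 2 ∧ J3 D = -30 * t ^ 3 := by
    by_cases ha : a = 0
    · subst ha
      exact ⟨0, by simp, by simpa using h1⟩
    · have hq : J3 D ^ 2 = 9 / 10 * a ^ 3 := by linarith
      refine ⟨-J3 D / (3 * a), ?_, ?_⟩
      · field_simp
        linarith
      · field_simp
        rw [show J3 D ^ 3 = J3 D * J3 D ^ 2 by ring, hq]
        ring
  rcases lt_trichotomy t 0 with ht | rfl | ht
  · obtain ⟨g, δ, σ, hg, e⟩ := exists_act_eq_NFtrig_of_eq_of_pos (t := -t) hD.neg (by linarith)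
      (by rw [d2_neg, h, neg_sq]) (by rw [J3_neg, h3]; ring)
    exact ⟨g, -δ, -σ, hg, by rw [NFtrig_neg, ← e, act_neg, neg_neg]⟩
  · have h0 : D = 0 := eq_zero_of_J2_eq_zero hD (by rw [J2_of_diagonal h]; simp)
    refine ⟨1, 0, 0, IsSO3.one, ?_⟩
    rw [act_one, h0]
    funext i j k l
    simp [NFtrig, symT]
  · exact exists_act_eq_NFtrig_of_eq_of_pos hD ht h h3

/-- a harmonic tensor `D ∈ H⁴` lies in the closed trigonal stratum iff its
fundamental invariants satisfy the eight listed syzygies together with the inequality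
`2J₂(J₂² − 3J₄)² − 35J₅² ≥ 0`; moreover, if also `3J₄ − J₂² ≠ 0` and `98J₄ − 41J₂² ≠ 0`,
then `g, δ, σ` can be chosen with `δ = −J₅/(4(J₂² − 3J₄))`, `σ ≥ 0` and
`J₂ = 280δ² + 16σ²`. -/
theorem trigonal_stratum_characterization (D : T4) (hD : IsHarm D) :
    ((∃ (g : Mat3) (δ σ : ℝ), IsSO3 g ∧ act g D = NFtrig δ σ) ↔
      (192 * J6 D = -51 * (J2 D) ^ 3 + 216 * J2 D * J4 D + 10 * (J3 D) ^ 2 ∧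
       36 * J7 D = -2 * (J2 D) ^ 2 * J3 D + 6 * J3 D * J4 D + 27 * J2 D * J5 D ∧
       768 * (J4 D) ^ 2 = -99 * (J2 D) ^ 4 + 552 * (J2 D) ^ 2 * J4 D +
         10 * J2 D * (J3 D) ^ 2 + 240 * J3 D * J5 D ∧
       240 * J8 D = -33 * (J2 D) ^ 4 + 96 * (J2 D) ^ 2 * J4 D +
         30 * J2 D * (J3 D) ^ 2 + 40 * J3 D * J5 D ∧
       576 * J4 D * J5 D = -41 * (J2 D) ^ 3 * J3 D + 120 * J2 D * J3 D * J4 D +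
         216 * (J2 D) ^ 2 * J5 D + 30 * (J3 D) ^ 3 ∧
       1152 * J9 D = -99 * (J2 D) ^ 3 * J3 D + 296 * J2 D * J3 D * J4 D +
         648 * (J2 D) ^ 2 * J5 D + 10 * (J3 D) ^ 3 ∧
       1440 * (J5 D) ^ 2 = -11 * (J2 D) ^ 5 + 32 * (J2 D) ^ 3 * J4 D -
         70 * (J2 D) ^ 2 * (J3 D) ^ 2 + 240 * J2 D * J3 D * J5 D +
         240 * (J3 D) ^ 2 * J4 D ∧
       8640 * J10 D = -891 * (J2 D) ^ 5 + 2592 * (J2 D) ^ 3 * J4 D +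
         730 * (J2 D) ^ 2 * (J3 D) ^ 2 + 2160 * J2 D * J3 D * J5 D +
         240 * (J3 D) ^ 2 * J4 D ∧
       2 * J2 D * ((J2 D) ^ 2 - 3 * J4 D) ^ 2 - 35 * (J5 D) ^ 2 ≥ 0)) ∧
    ((∃ (g : Mat3) (δ σ : ℝ), IsSO3 g ∧ act g D = NFtrig δ σ) →
      3 * J4 D - (J2 D) ^ 2 ≠ 0 → 98 * J4 D - 41 * (J2 D) ^ 2 ≠ 0 →
      ∃ (g : Mat3) (δ σ : ℝ), IsSO3 g ∧ act g D = NFtrig δ σ ∧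
        δ = -J5 D / (4 * ((J2 D) ^ 2 - 3 * J4 D)) ∧ σ ≥ 0 ∧
        J2 D = 280 * δ ^ 2 + 16 * σ ^ 2) := by
  have hmoreover : ∀ {g : Mat3} {δ σ : ℝ}, IsSO3 g → act g D = NFtrig δ σ →
      3 * J4 D - (J2 D) ^ 2 ≠ 0 → ∃ (g : Mat3) (δ σ : ℝ), IsSO3 g ∧ act g D = NFtrig δ σ ∧
        δ = -J5 D / (4 * ((J2 D) ^ 2 - 3 * J4 D)) ∧ σ ≥ 0 ∧
        J2 D = 280 * δ ^ 2 + 16 * σ ^ 2 := by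
    intro g δ σ hg e hne
    obtain ⟨g', σ', hg', hσ', e'⟩ := exists_act_eq_NFtrig δ 0 (-σ)
    rw [← NFtrig_eq_harmT, ← e, act_act] at e'
    have hG := hg'.mul hg
    have hd := d2_NFtrig δ σ'
    rw [← e'] at hd
    have h2 := J2_of_diagonal hd
    have h4 := J4_of_diagonal hd
    have h5 := J5_of_diagonal (hD.act hG) hd
    rw [e', NFtrig_eq_harmT, show harmT (8 * δ) (-(4 * δ)) 0 0 0 0 (-σ') 0 δ 2 2 2 2 = 8 * δ from
      rfl, ← NFtrig_eq_harmT, ← e'] at h5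
    rw [J2_act hG] at h2
    rw [J4_act hG] at h4
    rw [J5_act hG] at h5
    refine ⟨g' * g, δ, σ', hG, e', ?_, hσ', by linarith⟩
    have hne' : 4 * ((J2 D) ^ 2 - 3 * J4 D) ≠ 0 := fun h => hne (by linarith)
    rw [eq_div_iff hne', h2, h4, h5]
    ring
  refine ⟨⟨?_, ?_⟩, fun ⟨g, δ, σ, hg, e⟩ hne _ => hmoreover hg e hne⟩
  · rintro ⟨g, δ, σ, hg, e⟩
    have key := trigonal_relations_NFtrig e
    rwa [J2_act hg, J3_act hg, J4_act hg, J5_act hg, J6_act hg, J7_act hg, J8_act hg, J9_act hg,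
      J10_act hg] at key
  · rintro ⟨h1, h2, h3, h4, h5, -, h7, -, -⟩
    obtain ⟨g, a, b, hg, h⟩ := exists_isSO3_d2_double_eigenvalue hD h1 h3 h5
    have hg' : ∃ (g' : Mat3) (δ σ : ℝ), IsSO3 g' ∧ act g' (act g D) = NFtrig δ σ := by
      rw [← J2_act hg, ← J3_act hg, ← J4_act hg] at h1 h2 h4 h7
      rw [← J6_act hg] at h1
      rw [← J5_act hg] at h2 h4 h7
      rw [← J7_act hg] at h2
      rw [← J8_act hg] at h4
      by_cases hab : a = b
      · subst hab
        exact exists_act_eq_NFtrig_of_eq (hD.act hg) h h1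
      · exact exists_act_eq_NFtrig_of_ne (hD.act hg) h hab h1 h2 h4 h7
    obtain ⟨g', δ, σ, hg', e⟩ := hg'
    exact ⟨g' * g, δ, σ, hg'.mul hg, by rw [← act_act, e]⟩
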